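/- arXiv:2108.11769 — 6 statements merged into one kernel-verified Lean document; each statement's English description precedes it below -/
import Mathlib

section
/- Suppose f ≥ 1 and the non-faulty agents satisfy 2f-redundancy. If each non-faulty cost q^i is convex and differentiable, the gradients of the q^i are L-Lipschitz, and the average non-faulty cost q^H is μ-strongly convex with unique minimizer x*_H, then x*_H is a global minimizer of q^i for every non-faulty agent i ∈ H; equivalently, x*_H lies in the intersection ∩_{i∈H} argmin_x q^i(x). -/
open scoped RealInnerProductSpace

/-- A critical point of a convex function on a normed space is a global minimizer. -/
theorem ConvexOn.le_of_hasFDerivAt_zero {E : Type*} [NormedAddCommGroup E] [NormedSpace ℝ E]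
    {φ : E → ℝ} {x : E} (hφ : ConvexOn ℝ Set.univ φ) (hx : HasFDerivAt φ (0 : E →L[ℝ] ℝ) x)
    (y : E) : φ x ≤ φ y := by
  have hc : ConvexOn ℝ Set.univ (φ ∘ AffineMap.lineMap (k := ℝ) x y) := by
    simpa using hφ.comp_affineMap (AffineMap.lineMap (k := ℝ) x y)
  have hx' : HasFDerivAt φ (0 : E →L[ℝ] ℝ) (AffineMap.lineMap (k := ℝ) x y 0) := by
    simpa using hx
  have hd : HasDerivAt (φ ∘ AffineMap.lineMap (k := ℝ) x y) 0 0 := by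
    simpa using hx'.comp_hasDerivAt (0 : ℝ) AffineMap.hasDerivAt_lineMap
  simpa [slope_def_field] using
    hc.le_slope_of_hasDerivAt (Set.mem_univ 0) (Set.mem_univ 1) zero_lt_one hd

/-- Under `2f`-redundancy, the unique minimizer `x*_H` of the average non-faulty cost
`q^H` is a global minimizer of every non-faulty agent's cost `q^i` (`i ∈ H`), i.e.,
`x*_H ∈ ⋂_{i ∈ H} argmin q^i`. -/
theorem redundancy_implies_common_minimizer
    (dim N f : ℕ) (hf1 : 1 ≤ f) (hfN : 2 * f < N)
    (H : Finset (Fin N)) (hHcard : H.card = N - f)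
    (q : Fin N → EuclideanSpace ℝ (Fin dim) → ℝ)
    (g : Fin N → EuclideanSpace ℝ (Fin dim) → EuclideanSpace ℝ (Fin dim))
    (L μ : ℝ) (hμ : 0 < μ) (hμL : μ ≤ L)
    -- each non-faulty cost is convex and differentiable with gradient `g i`
    (hconv : ∀ i ∈ H, ConvexOn ℝ Set.univ (q i))
    (hgrad : ∀ i ∈ H, ∀ x, HasGradientAt (q i) (g i x) x)
    -- the gradients are `L`-Lipschitz
    (hlip : ∀ i ∈ H, ∀ x y, ‖g i x - g i y‖ ≤ L * ‖x - y‖)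
    -- the average non-faulty cost `q^H = (1/|H|) ∑_{i ∈ H} q^i` is `μ`-strongly convex
    (hsc : ∀ x y : EuclideanSpace ℝ (Fin dim),
      μ * ‖x - y‖ ^ 2 ≤ ⟪x - y, (H.card : ℝ)⁻¹ • ∑ i ∈ H, (g i x - g i y)⟫)
    -- `2f`-redundancy: for every `S ⊆ H` with `|S| ≥ N - 2f`,
    -- `argmin ∑_{i ∈ S} q^i = argmin ∑_{i ∈ H} q^i`
    (hred : ∀ S ⊆ H, N - 2 * f ≤ S.card →
      ∀ x : EuclideanSpace ℝ (Fin dim),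
        (∀ y, ∑ i ∈ S, q i x ≤ ∑ i ∈ S, q i y) ↔ (∀ y, ∑ i ∈ H, q i x ≤ ∑ i ∈ H, q i y))
    -- `x*_H` is the (unique) global minimizer of `q^H`
    (xstar : EuclideanSpace ℝ (Fin dim))
    (hmin : ∀ y, (H.card : ℝ)⁻¹ * ∑ i ∈ H, q i xstar ≤ (H.card : ℝ)⁻¹ * ∑ i ∈ H, q i y) :
    ∀ i ∈ H, ∀ y, q i xstar ≤ q i y := by
  intro i hi
  have hcard : 0 < (H.card : ℝ) := by exact_mod_cast Finset.card_pos.mpr ⟨i, hi⟩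
  have hminH : ∀ y, ∑ j ∈ H, q j xstar ≤ ∑ j ∈ H, q j y := fun y =>
    le_of_mul_le_mul_left (hmin y) (inv_pos.mpr hcard)
  have hminS : ∀ y, ∑ j ∈ H.erase i, q j xstar ≤ ∑ j ∈ H.erase i, q j y := by
    refine (hred _ (H.erase_subset i) ?_ xstar).mpr hminH
    rw [Finset.card_erase_of_mem hi]
    omega
  have hderiv : ∀ S ⊆ H, (∀ y, ∑ j ∈ S, q j xstar ≤ ∑ j ∈ S, q j y) →
      HasFDerivAt (fun x => ∑ j ∈ S, q j x)
        (0 : EuclideanSpace ℝ (Fin dim) →L[ℝ] ℝ) xstar := by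
    intro S hS hminS
    have h := HasFDerivAt.fun_sum fun j hj => (hgrad j (hS hj) xstar).hasFDerivAt
    have hloc : IsLocalMin (fun x => ∑ j ∈ S, q j x) xstar := Filter.Eventually.of_forall hminS
    rwa [hloc.hasFDerivAt_eq_zero h] at h
  have hi_eq : q i = fun x => ∑ j ∈ H, q j x - ∑ j ∈ H.erase i, q j x := by
    funext x
    rw [← Finset.add_sum_erase H (fun j => q j x) hi, add_sub_cancel_right]
  refine (hconv i hi).le_of_hasFDerivAt_zero ?_
  rw [hi_eq]
  simpa using (hderiv H subset_rfl hminH).fun_sub (hderiv _ (H.erase_subset i) hminS)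
end

section
/- Suppose f ≥ 1 and the non-faulty agents satisfy 2f-redundancy. If each non-faulty cost q^i is differentiable, the gradients of the q^i are L-Lipschitz, and the average non-faulty cost q^H is μ-strongly convex with unique minimizer x*_H, then ∇q^i(x*_H) = 0 for every non-faulty agent i ∈ H. -/
open scoped RealInnerProductSpace

/-- At a global minimizer of a finite sum of functions, their gradients sum to zero. -/
theorem sum_gradient_eq_zero_of_forall_sum_le {ι E : Type*} [NormedAddCommGroup E]
    [InnerProductSpace ℝ E] [CompleteSpace E] {S : Finset ι} {q : ι → E → ℝ} {g : ι → E} {x : E}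
    (hgrad : ∀ i ∈ S, HasGradientAt (q i) (g i) x)
    (hmin : ∀ y, ∑ i ∈ S, q i x ≤ ∑ i ∈ S, q i y) : ∑ i ∈ S, g i = 0 := by
  have hderiv := HasFDerivAt.fun_sum fun i hi => (hgrad i hi).hasFDerivAt
  have hloc : IsLocalMin (fun y => ∑ i ∈ S, q i y) x := Filter.Eventually.of_forall hmin
  have hzero := hloc.hasFDerivAt_eq_zero hderiv
  rw [← map_sum] at hzero
  exact (InnerProductSpace.toDual ℝ E).map_eq_zero_iff.mp hzero

/-- Under `2f`-redundancy, the gradient of every non-faulty agent's cost `q^i` (`i ∈ H`)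
vanishes at the unique minimizer `x*_H` of the average non-faulty cost `q^H`. -/
theorem redundancy_implies_vanishing_gradients
    (dim N f : ℕ) (hf1 : 1 ≤ f) (hfN : 2 * f < N)
    (H : Finset (Fin N)) (hHcard : H.card = N - f)
    (q : Fin N → EuclideanSpace ℝ (Fin dim) → ℝ)
    (g : Fin N → EuclideanSpace ℝ (Fin dim) → EuclideanSpace ℝ (Fin dim))
    (L μ : ℝ) (hμ : 0 < μ) (hμL : μ ≤ L)
    -- each non-faulty cost is differentiable with gradient `g i`
    (hgrad : ∀ i ∈ H, ∀ x, HasGradientAt (q i) (g i x) x)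
    -- the gradients are `L`-Lipschitz
    (hlip : ∀ i ∈ H, ∀ x y, ‖g i x - g i y‖ ≤ L * ‖x - y‖)
    -- the average non-faulty cost `q^H = (1/|H|) ∑_{i ∈ H} q^i` is `μ`-strongly convex
    (hsc : ∀ x y : EuclideanSpace ℝ (Fin dim),
      μ * ‖x - y‖ ^ 2 ≤ ⟪x - y, (H.card : ℝ)⁻¹ • ∑ i ∈ H, (g i x - g i y)⟫)
    -- `2f`-redundancy: for every `S ⊆ H` with `|S| ≥ N - 2f`,
    -- `argmin ∑_{i ∈ S} q^i = argmin ∑_{i ∈ H} q^i`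
    (hred : ∀ S ⊆ H, N - 2 * f ≤ S.card →
      ∀ x : EuclideanSpace ℝ (Fin dim),
        (∀ y, ∑ i ∈ S, q i x ≤ ∑ i ∈ S, q i y) ↔ (∀ y, ∑ i ∈ H, q i x ≤ ∑ i ∈ H, q i y))
    -- `x*_H` is the (unique) global minimizer of `q^H`
    (xstar : EuclideanSpace ℝ (Fin dim))
    (hmin : ∀ y, (H.card : ℝ)⁻¹ * ∑ i ∈ H, q i xstar ≤ (H.card : ℝ)⁻¹ * ∑ i ∈ H, q i y) :
    ∀ i ∈ H, g i xstar = 0 := by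
  intro i hi
  have hpos : (0 : ℝ) < (H.card : ℝ)⁻¹ := by
    have : 0 < H.card := Finset.card_pos.mpr ⟨i, hi⟩
    positivity
  have hminH : ∀ y, ∑ j ∈ H, q j xstar ≤ ∑ j ∈ H, q j y := fun y =>
    le_of_mul_le_mul_left (hmin y) hpos
  have hcard : N - 2 * f ≤ (H.erase i).card := by
    rw [Finset.card_erase_of_mem hi]
    omega
  have hminErase := (hred (H.erase i) (H.erase_subset i) hcard xstar).mpr hminH
  have hsumH := sum_gradient_eq_zero_of_forall_sum_le (fun j hj => hgrad j hj xstar) hminH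
  have hsumErase := sum_gradient_eq_zero_of_forall_sum_le
    (fun j hj => hgrad j (Finset.mem_of_mem_erase hj) xstar) hminErase
  rwa [← Finset.add_sum_erase H _ hi, hsumErase, add_zero] at hsumH
end

section
/- Let x̄ ∈ ℝ^d, let v : {1,…,N} → ℝ^d be submitted vectors, let H ⊆ {1,…,N} with |H| = N − f and f < N, and let F ⊆ {1,…,N} with |F| = N − f satisfy ‖x̄ − v_j‖ ≤ ‖x̄ − v_l‖ for every j ∈ F and every l ∉ F. Then the filtered average deviates from the non-faulty average by at most ‖(1/(N−f)) Σ_{j∈F} v_j − (1/(N−f)) Σ_{i∈H} v_i‖ ≤ (2f/(N−f)) · max_{i∈H} ‖x̄ − v_i‖. -/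
/-- If `F` and `H` have equal cardinality and the terms of `F` are closest to `x`, then any bound
`M` on the distances from `x` to the terms of `H` controls the difference of the two sums. -/
theorem norm_sum_sub_sum_le_of_closest {ι E : Type*} [DecidableEq ι] [SeminormedAddCommGroup E]
    (x : E) (v : ι → E) {F H : Finset ι} (hcard : F.card = H.card)
    (hsel : ∀ j ∈ F, ∀ l ∉ F, ‖x - v j‖ ≤ ‖x - v l‖)
    {M : ℝ} (hM : ∀ i ∈ H, ‖x - v i‖ ≤ M) :
    ‖∑ j ∈ F, v j - ∑ i ∈ H, v i‖ ≤ 2 * (F \ H).card * M := by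
  have hsd : (F \ H).card = (H \ F).card := Finset.card_sdiff_comm hcard
  have hF : ∀ j ∈ F \ H, ‖x - v j‖ ≤ M := by
    intro j hj
    obtain ⟨l, hl⟩ : (H \ F).Nonempty :=
      Finset.card_pos.mp (hsd ▸ Finset.card_pos.mpr ⟨j, hj⟩)
    rw [Finset.mem_sdiff] at hj hl
    exact (hsel j hj.1 l hl.2).trans (hM l hl.1)
  have hH : ∀ i ∈ H \ F, ‖x - v i‖ ≤ M := fun i hi => hM i (Finset.mem_sdiff.mp hi).1
  have key : ∑ j ∈ F, v j - ∑ i ∈ H, v i =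
      ∑ i ∈ H \ F, (x - v i) - ∑ j ∈ F \ H, (x - v j) := by
    rw [Finset.sum_sdiff_sub_sum_sdiff, Finset.sum_sub_distrib, Finset.sum_sub_distrib,
      Finset.sum_const, Finset.sum_const, hcard]
    abel
  calc ‖∑ j ∈ F, v j - ∑ i ∈ H, v i‖
      ≤ ‖∑ i ∈ H \ F, (x - v i)‖ + ‖∑ j ∈ F \ H, (x - v j)‖ := key ▸ norm_sub_le _ _
    _ ≤ (H \ F).card • M + (F \ H).card • M :=
        add_le_add ((norm_sum_le _ _).trans (Finset.sum_le_card_nsmul _ _ _ hH))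
          ((norm_sum_le _ _).trans (Finset.sum_le_card_nsmul _ _ _ hF))
    _ = 2 * (F \ H).card * M := by
        rw [← hsd, nsmul_eq_mul]
        ring

/-- **Deviation of the CE-filtered average from the non-faulty average.**
If the CE filter retains a set `F` of `N - f` submitted vectors closest to the current
estimate `x̄`, then the average of the retained vectors deviates from the average of the
non-faulty vectors by at most `(2f/(N-f)) · max_{i ∈ H} ‖x̄ - v i‖`. -/
theorem ce_filter_average_deviation
    (dim N f : ℕ) (hfN : f < N)
    (xbar : EuclideanSpace ℝ (Fin dim))
    (v : Fin N → EuclideanSpace ℝ (Fin dim))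
    (H : Finset (Fin N)) (hH : H.card = N - f)
    (F : Finset (Fin N)) (hF : F.card = N - f)
    (hsel : ∀ j ∈ F, ∀ l ∉ F, ‖xbar - v j‖ ≤ ‖xbar - v l‖) :
    ‖((N : ℝ) - f)⁻¹ • ∑ j ∈ F, v j - ((N : ℝ) - f)⁻¹ • ∑ i ∈ H, v i‖ ≤
      (2 * f / ((N : ℝ) - f)) * H.sup' (Finset.card_pos.mp (by omega)) (fun i => ‖xbar - v i‖) := by
  have hne : H.Nonempty := Finset.card_pos.mp (by omega)
  set M := H.sup' hne (fun i => ‖xbar - v i‖)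
  have hM : ∀ i ∈ H, ‖xbar - v i‖ ≤ M := fun i hi =>
    Finset.le_sup' (fun i => ‖xbar - v i‖) hi
  have hM0 : 0 ≤ M := (norm_nonneg _).trans (hM _ hne.choose_spec)
  have hNf : 0 < (N : ℝ) - f := sub_pos.mpr (Nat.cast_lt.mpr hfN)
  have hk : (F \ H).card ≤ f := by
    have h : (F \ H).card ≤ Hᶜ.card :=
      Finset.card_le_card fun i hi => Finset.mem_compl.mpr (Finset.mem_sdiff.mp hi).2
    rw [Finset.card_compl, Fintype.card_fin, hH] at h
    omega
  rw [← smul_sub, norm_smul, Real.norm_of_nonneg (inv_nonneg.mpr hNf.le)]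
  calc ((N : ℝ) - f)⁻¹ * ‖∑ j ∈ F, v j - ∑ i ∈ H, v i‖
      ≤ ((N : ℝ) - f)⁻¹ * (2 * (F \ H).card * M) := by
        gcongr
        exact norm_sum_sub_sum_le_of_closest xbar v (hF.trans hH.symm) hsel hM
    _ ≤ ((N : ℝ) - f)⁻¹ * (2 * f * M) := by gcongr
    _ = 2 * f / ((N : ℝ) - f) * M := by ring
end

section
/- Assume the gradients of the non-faulty costs q^i (i ∈ H) are L-Lipschitz, the average non-faulty cost q^H is μ-strongly convex with 0 < μ ≤ L and unique minimizer x*_H, ∇q^i(x*_H) = 0 for every i ∈ H, and f/(N−f) ≤ μ/(3L). Let 0 < α ≤ μ/(4L²). For any x̄ ∈ ℝ^d, suppose each non-faulty agent i ∈ H submits v_i = x̄ − α∇q^i(x̄), each faulty agent j ∉ H submits an arbitrary vector v_j ∈ ℝ^d, F ⊆ {1,…,N} with |F| = N − f satisfies ‖x̄ − v_j‖ ≤ ‖x̄ − v_l‖ for all j ∈ F and l ∉ F, and x̄' = (1/(N−f)) Σ_{i∈F} v_i. Then ‖x̄' − x*_H‖² ≤ (1 − μα/6) ‖x̄ − x*_H‖².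 -/
open scoped RealInnerProductSpace

/-- If `F` and `H` have the same cardinality and `F` selects the vectors of smallest norm, then
replacing `H` by `F` changes the sum by at most twice the number of indices outside `H` times
a bound for the norms over `H`. -/
theorem norm_sum_sub_sum_le_of_smallest {ι E : Type*} [Fintype ι] [DecidableEq ι]
    [SeminormedAddCommGroup E] {F H : Finset ι} (hcard : F.card = H.card) {u : ι → E} {B : ℝ}
    (hB : 0 ≤ B) (hu : ∀ i ∈ H, ‖u i‖ ≤ B) (hsel : ∀ j ∈ F, ∀ l ∉ F, ‖u j‖ ≤ ‖u l‖) :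
    ‖∑ i ∈ F, u i - ∑ i ∈ H, u i‖ ≤ 2 * (Hᶜ.card : ℝ) * B := by
  have hdiff : (F \ H).card = (H \ F).card := Finset.card_sdiff_comm hcard
  have hle : ((F \ H).card : ℝ) ≤ Hᶜ.card := by
    exact_mod_cast Finset.card_le_card fun i hi => by
      simpa using (Finset.mem_sdiff.mp hi).2
  have hF : ∀ j ∈ F \ H, ‖u j‖ ≤ B := by
    intro j hj
    obtain ⟨l, hl⟩ : (H \ F).Nonempty := by
      rw [← Finset.card_pos, ← hdiff]
      exact Finset.card_pos.mpr ⟨j, hj⟩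
    rw [Finset.mem_sdiff] at hj hl
    exact (hsel j hj.1 l hl.2).trans (hu l hl.1)
  have h1 : ‖∑ i ∈ F \ H, u i‖ ≤ (F \ H).card * B := by
    simpa using norm_sum_le_of_le _ hF
  have h2 : ‖∑ i ∈ H \ F, u i‖ ≤ (F \ H).card * B := by
    rw [hdiff]
    simpa using norm_sum_le_of_le _ fun i hi => hu i (Finset.mem_sdiff.mp hi).1
  rw [← Finset.sum_sdiff_sub_sum_sdiff]
  calc _ ≤ (F \ H).card * B + (F \ H).card * B := (norm_sub_le _ _).trans (add_le_add h1 h2)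
    _ ≤ _ := by nlinarith

/-- A gradient step with small step size along a strongly monotone, linearly bounded direction
contracts, even under a perturbation of size at most `2 / 3 * (α * μ)` relative to the error. -/
theorem norm_sq_perturbed_step_le {E : Type*} [NormedAddCommGroup E] [InnerProductSpace ℝ E]
    {e G p : E} {L μ α : ℝ} (hμ : 0 < μ) (hμL : μ ≤ L) (hα0 : 0 < α)
    (hα : α ≤ μ / (4 * L ^ 2)) (hG : ‖G‖ ≤ L * ‖e‖) (hinner : μ * ‖e‖ ^ 2 ≤ ⟪e, G⟫)
    (hp : ‖p‖ ≤ 2 / 3 * (α * μ) * ‖e‖) :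
    ‖e - α • G + p‖ ^ 2 ≤ (1 - μ * α / 6) * ‖e‖ ^ 2 := by
  have hL : 0 < L := hμ.trans_le hμL
  have hαL : α * (4 * L ^ 2) ≤ μ := (le_div_iff₀ (by positivity)).mp hα
  have ha0 : 0 < α * μ := by positivity
  have ha : α * μ ≤ 1 / 4 := by
    have hαμ : α * μ * (4 * μ) ≤ 1 * μ := by
      have : μ ^ 2 ≤ L ^ 2 := by gcongr
      nlinarith
    have := le_of_mul_le_mul_right (a := μ) (b := 4 * (α * μ)) (c := 1) (by linarith) hμ
    linarith
  have hG2 : ‖G‖ ^ 2 ≤ L ^ 2 * ‖e‖ ^ 2 := by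
    rw [← mul_pow]
    gcongr
  have hstep2 : ‖e - α • G‖ ^ 2 ≤ ((1 - 7 / 8 * (α * μ)) * ‖e‖) ^ 2 := by
    rw [norm_sub_sq_real, inner_smul_right, norm_smul, mul_pow, Real.norm_eq_abs, sq_abs]
    have h1 : α * (μ * ‖e‖ ^ 2) ≤ α * ⟪e, G⟫ := by gcongr
    have h2 : α ^ 2 * ‖G‖ ^ 2 ≤ α ^ 2 * (L ^ 2 * ‖e‖ ^ 2) := by gcongr
    have h3 : α * (4 * L ^ 2) * (α * ‖e‖ ^ 2) ≤ μ * (α * ‖e‖ ^ 2) := by gcongr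
    nlinarith [sq_nonneg (α * μ * ‖e‖)]
  have hstep : ‖e - α • G‖ ≤ (1 - 7 / 8 * (α * μ)) * ‖e‖ :=
    (sq_le_sq₀ (norm_nonneg _) (mul_nonneg (by linarith) (norm_nonneg e))).mp hstep2
  have htotal : ‖e - α • G + p‖ ≤ (1 - 5 / 24 * (α * μ)) * ‖e‖ := by
    linarith [norm_add_le (e - α • G) p]
  calc _ ≤ ((1 - 5 / 24 * (α * μ)) * ‖e‖) ^ 2 := by gcongr
    _ = (1 - 5 / 24 * (α * μ)) ^ 2 * ‖e‖ ^ 2 := mul_pow _ _ _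
    _ ≤ _ := by
      gcongr
      nlinarith

/-- **Single-iteration contraction of local GD with the CE filter (`T = 1`, deterministic).**
If each non-faulty agent submits one gradient-descent step from `x̄`, faulty agents submit
arbitrary vectors, and the coordinator averages the `N - f` submissions closest to `x̄`,
then the new estimate contracts towards `x*_H` at rate `1 - μα/6`. -/
theorem ce_one_iteration_contraction_T1
    (dim N f : ℕ)
    (H : Finset (Fin N)) (hHcard : H.card = N - f)
    (q : Fin N → EuclideanSpace ℝ (Fin dim) → ℝ)
    (g : Fin N → EuclideanSpace ℝ (Fin dim) → EuclideanSpace ℝ (Fin dim))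
    (L μ : ℝ) (hμ : 0 < μ) (hμL : μ ≤ L)
    (hgrad : ∀ i ∈ H, ∀ x, HasGradientAt (q i) (g i x) x)
    (hlip : ∀ i ∈ H, ∀ x y, ‖g i x - g i y‖ ≤ L * ‖x - y‖)
    (hsc : ∀ x y : EuclideanSpace ℝ (Fin dim),
      μ * ‖x - y‖ ^ 2 ≤ ⟪x - y, (H.card : ℝ)⁻¹ • ∑ i ∈ H, (g i x - g i y)⟫)
    (xstar : EuclideanSpace ℝ (Fin dim))
    (hstar : ∀ i ∈ H, g i xstar = 0)
    (hratio : (f : ℝ) / ((N : ℝ) - f) ≤ μ / (3 * L))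
    (α : ℝ) (hα0 : 0 < α) (hα : α ≤ μ / (4 * L ^ 2))
    (xbar : EuclideanSpace ℝ (Fin dim))
    (v : Fin N → EuclideanSpace ℝ (Fin dim))
    -- non-faulty agents submit one gradient-descent step from `x̄`
    (hv : ∀ i ∈ H, v i = xbar - α • g i xbar)
    -- the CE filter keeps the `N - f` submissions closest to `x̄`
    (F : Finset (Fin N)) (hFcard : F.card = N - f)
    (hsel : ∀ j ∈ F, ∀ l ∉ F, ‖xbar - v j‖ ≤ ‖xbar - v l‖)
    (xbar' : EuclideanSpace ℝ (Fin dim))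
    (hupd : xbar' = ((N : ℝ) - f)⁻¹ • ∑ i ∈ F, v i) :
    ‖xbar' - xstar‖ ^ 2 ≤ (1 - μ * α / 6) * ‖xbar - xstar‖ ^ 2 := by
  have hL : 0 < L := hμ.trans_le hμL
  rcases Nat.lt_or_ge f N with hfN | hNf
  · have hm : (H.card : ℝ) = N - f := by rw [hHcard, Nat.cast_sub hfN.le]
    have hm0 : (0 : ℝ) < N - f := sub_pos.mpr (by exact_mod_cast hfN)
    have hcompl : Hᶜ.card = f := by
      rw [Finset.card_compl, Fintype.card_fin, hHcard]
      lia
    have hg : ∀ i ∈ H, ‖g i xbar‖ ≤ L * ‖xbar - xstar‖ := fun i hi => by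
      simpa [hstar i hi] using hlip i hi xbar xstar
    have hdev : ‖∑ i ∈ F, (v i - xbar) - ∑ i ∈ H, (v i - xbar)‖
        ≤ 2 * (f : ℝ) * (α * (L * ‖xbar - xstar‖)) := by
      rw [← hcompl]
      refine norm_sum_sub_sum_le_of_smallest (hFcard.trans hHcard.symm) (by positivity) ?_ ?_
      · intro i hi
        rw [hv i hi, sub_sub_cancel_left, norm_neg, norm_smul, Real.norm_of_nonneg hα0.le]
        gcongr
        exact hg i hi
      · simpa only [norm_sub_rev xbar] using hsel
    set m : ℝ := (N : ℝ) - f with hm_def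
    set p := m⁻¹ • (∑ i ∈ F, (v i - xbar) - ∑ i ∈ H, (v i - xbar)) with hp_def
    set G := m⁻¹ • ∑ i ∈ H, g i xbar with hG_def
    have hG : ‖G‖ ≤ L * ‖xbar - xstar‖ := by
      rw [hG_def, norm_smul, norm_inv, Real.norm_of_nonneg hm0.le, inv_mul_le_iff₀ hm0, ← hm]
      simpa using norm_sum_le_of_le _ hg
    have hinner : μ * ‖xbar - xstar‖ ^ 2 ≤ ⟪xbar - xstar, G⟫ := by
      have h := hsc xbar xstar
      rwa [Finset.sum_congr rfl fun i hi => by rw [hstar i hi, sub_zero], hm] at h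
    have hp : ‖p‖ ≤ 2 / 3 * (α * μ) * ‖xbar - xstar‖ := by
      have hfL : (f : ℝ) / m * L ≤ μ / 3 := by
        calc (f : ℝ) / m * L ≤ μ / (3 * L) * L := by gcongr
          _ = μ / 3 := by field_simp
      calc ‖p‖ ≤ m⁻¹ * (2 * (f : ℝ) * (α * (L * ‖xbar - xstar‖))) := by
            rw [hp_def, norm_smul, norm_inv, Real.norm_of_nonneg hm0.le]
            gcongr
        _ = 2 * α * ‖xbar - xstar‖ * (f / m * L) := by ring
        _ ≤ 2 * α * ‖xbar - xstar‖ * (μ / 3) := by gcongr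
        _ = _ := by ring
    have hdecomp : xbar' - xstar = xbar - xstar - α • G + p := by
      have hH : ∑ i ∈ H, (v i - xbar) = -(α • ∑ i ∈ H, g i xbar) := by
        rw [Finset.smul_sum, ← Finset.sum_neg_distrib]
        exact Finset.sum_congr rfl fun i hi => by rw [hv i hi, sub_sub_cancel_left]
      have hF : ∑ i ∈ F, (v i - xbar) = ∑ i ∈ F, v i - m • xbar := by
        rw [Finset.sum_sub_distrib, Finset.sum_const, ← Nat.cast_smul_eq_nsmul ℝ,
          hFcard, ← hHcard, hm]
      rw [hupd, hp_def, hG_def, hH, hF, smul_sub, smul_sub, inv_smul_smul₀ hm0.ne', smul_neg,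
        smul_comm α]
      abel
    rw [hdecomp]
    exact norm_sq_perturbed_step_le hμ hμL hα0 hα hG hinner hp
  · have hH : H = ∅ := by
      rw [← Finset.card_eq_zero, hHcard, Nat.sub_eq_zero_of_le hNf]
    have heq : ∀ x : EuclideanSpace ℝ (Fin dim), ‖x - xstar‖ ^ 2 = 0 := fun x => by
      have h := hsc x xstar
      simp only [hH, Finset.sum_empty, smul_zero, inner_zero_right] at h
      exact le_antisymm (nonpos_of_mul_nonpos_right h hμ) (sq_nonneg _)
    rw [heq, heq, mul_zero]
end

section
/- (Theorem 1.) Assume the gradients of the non-faulty costs q^i (i ∈ H) are L-Lipschitz, the average non-faulty cost q^H is μ-strongly convex with 0 < μ ≤ L and unique minimizer x*_H, ∇q^i(x*_H) = 0 for every i ∈ H (which holds under 2f-redundancy), and f/(N−f) ≤ μ/(3L). Consider any deterministic execution of the local gradient-descent algorithm with CE filter, T = 1 local step, and constant step size α with 0 < α ≤ μ/(4L²): for each iteration k, every non-faulty agent i ∈ H submits v^k_i = x̄_k − α∇q^i(x̄_k), every faulty agent j ∉ H submits an arbitrary vector v^k_j ∈ ℝ^d, F_k ⊆ {1,…,N}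 with |F_k| = N − f satisfies ‖x̄_k − v^k_j‖ ≤ ‖x̄_k − v^k_l‖ for all j ∈ F_k and l ∉ F_k, and x̄_{k+1} = (1/(N−f)) Σ_{i∈F_k} v^k_i. Then for every k ≥ 0, ‖x̄_k − x*_H‖² ≤ (1 − μα/6)^k ‖x̄_0 − x*_H‖². -/
open scoped RealInnerProductSpace

/-- If each of two finsets has at most `f` elements outside the other and `d` is bounded by `c` on
both, then the sums of `d` over them differ by at most `2 f c`. -/
theorem norm_sum_sub_sum_le_of_card_sdiff_le {ι E : Type*} [DecidableEq ι]
    [SeminormedAddCommGroup E] {s t : Finset ι} {d : ι → E} {c : ℝ} {f : ℕ} (hc : 0 ≤ c)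
    (hst : (s \ t).card ≤ f) (hts : (t \ s).card ≤ f)
    (hs : ∀ i ∈ s, ‖d i‖ ≤ c) (ht : ∀ i ∈ t, ‖d i‖ ≤ c) :
    ‖∑ i ∈ s, d i - ∑ i ∈ t, d i‖ ≤ 2 * f * c := by
  have key : ∀ u : Finset ι, u.card ≤ f → (∀ i ∈ u, ‖d i‖ ≤ c) → ‖∑ i ∈ u, d i‖ ≤ f * c := by
    intro u hu hd
    calc ‖∑ i ∈ u, d i‖ ≤ ∑ _i ∈ u, c := norm_sum_le_of_le u hd
      _ = (u.card : ℝ) * c := by rw [Finset.sum_const, nsmul_eq_mul]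
      _ ≤ f * c := by gcongr
  rw [← Finset.sum_sdiff_sub_sum_sdiff]
  have h₁ := key _ hst fun i hi => hs i (Finset.sdiff_subset hi)
  have h₂ := key _ hts fun i hi => ht i (Finset.sdiff_subset hi)
  linarith [norm_sub_le (∑ i ∈ s \ t, d i) (∑ i ∈ t \ s, d i)]

/-- If a selection `F`, of the same size as `H`, keeps indices with smallest `‖d ·‖`, then any bound
for `‖d ·‖` on `H` also holds on `F`. -/
theorem norm_le_on_selection {ι E : Type*} [DecidableEq ι] [SeminormedAddCommGroup E]
    {F H : Finset ι} {d : ι → E} {c : ℝ} (hcard : F.card = H.card)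
    (hsel : ∀ j ∈ F, ∀ l ∉ F, ‖d j‖ ≤ ‖d l‖) (hH : ∀ i ∈ H, ‖d i‖ ≤ c) :
    ∀ i ∈ F, ‖d i‖ ≤ c := by
  intro i hi
  by_cases hiH : i ∈ H
  · exact hH i hiH
  · have hne : (F \ H).Nonempty := ⟨i, Finset.mem_sdiff.2 ⟨hi, hiH⟩⟩
    rw [← Finset.card_pos, Finset.card_sdiff_comm hcard, Finset.card_pos] at hne
    obtain ⟨l, hl⟩ := hne
    rw [Finset.mem_sdiff] at hl
    exact (hsel i hi l hl.2).trans (hH l hl.1)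

/-- One gradient step along `G` perturbed by `w` contracts the squared distance. -/
theorem norm_sq_sub_smul_add_le {E : Type*} [NormedAddCommGroup E] [InnerProductSpace ℝ E]
    {L μ α : ℝ} (hμ : 0 < μ) (hμL : μ ≤ L) (hα0 : 0 < α) (hα : α ≤ μ / (4 * L ^ 2))
    {e G w : E} (hG : ‖G‖ ≤ L * ‖e‖) (hin : μ * ‖e‖ ^ 2 ≤ ⟪e, G⟫)
    (hw : ‖w‖ ≤ 2 / 3 * (μ * α) * ‖e‖) :
    ‖e - α • G + w‖ ^ 2 ≤ (1 - μ * α / 6) * ‖e‖ ^ 2 := by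
  have hL : 0 < L := hμ.trans_le hμL
  have hαL : α * L ^ 2 ≤ μ / 4 := by
    rw [le_div_iff₀ (by positivity)] at hα
    linarith
  have ht0 : 0 < μ * α := mul_pos hμ hα0
  have ht : μ * α ≤ 1 / 4 := by
    have h₁ : μ ^ 2 ≤ L ^ 2 := by gcongr
    have h₂ : α * μ ^ 2 ≤ μ / 4 := (mul_le_mul_of_nonneg_left h₁ hα0.le).trans hαL
    nlinarith
  have hG2 : ‖G‖ ^ 2 ≤ L ^ 2 * ‖e‖ ^ 2 := by
    rw [← mul_pow]
    gcongr
  have hstep : ‖e - α • G‖ ≤ (1 - 7 / 8 * (μ * α)) * ‖e‖ := by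
    refine le_of_sq_le_sq ?_ (mul_nonneg (by linarith) (norm_nonneg e))
    rw [norm_sub_sq_real, real_inner_smul_right, norm_smul, Real.norm_of_nonneg hα0.le]
    have h₁ : α * ⟪e, G⟫ ≥ α * (μ * ‖e‖ ^ 2) := mul_le_mul_of_nonneg_left hin hα0.le
    have h₂ : α ^ 2 * ‖G‖ ^ 2 ≤ α ^ 2 * (L ^ 2 * ‖e‖ ^ 2) := by gcongr
    have h₃ : α * ‖e‖ ^ 2 * (α * L ^ 2) ≤ α * ‖e‖ ^ 2 * (μ / 4) := by gcongr
    nlinarith [sq_nonneg (μ * α * ‖e‖)]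
  have hnorm : ‖e - α • G + w‖ ≤ (1 - 5 / 24 * (μ * α)) * ‖e‖ := by
    linarith [norm_add_le (e - α • G) w]
  calc ‖e - α • G + w‖ ^ 2 ≤ ((1 - 5 / 24 * (μ * α)) * ‖e‖) ^ 2 := by gcongr
    _ = (1 - 5 / 24 * (μ * α)) ^ 2 * ‖e‖ ^ 2 := mul_pow _ _ _
    _ ≤ (1 - μ * α / 6) * ‖e‖ ^ 2 := by
      gcongr
      nlinarith

/-- **Theorem 1: exact fault-tolerance of local GD with the CE filter (`T = 1`, deterministic).**
Under `2f`-redundancy (used via `∇q^i(x*_H) = 0` for all `i ∈ H`), `f/(N-f) ≤ μ/(3L)`, and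
step size `0 < α ≤ μ/(4L²)`, the iterates of local gradient descent with the comparative
elimination filter satisfy `‖x̄_k - x*_H‖² ≤ (1 - μα/6)^k ‖x̄_0 - x*_H‖²`, for every possible
behaviour of the Byzantine agents. -/
theorem local_gd_ce_exact_fault_tolerance_T1
    (dim N f : ℕ)
    (H : Finset (Fin N)) (hHcard : H.card = N - f)
    (q : Fin N → EuclideanSpace ℝ (Fin dim) → ℝ)
    (g : Fin N → EuclideanSpace ℝ (Fin dim) → EuclideanSpace ℝ (Fin dim))
    (L μ : ℝ) (hμ : 0 < μ) (hμL : μ ≤ L)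
    (hgrad : ∀ i ∈ H, ∀ x, HasGradientAt (q i) (g i x) x)
    (hlip : ∀ i ∈ H, ∀ x y, ‖g i x - g i y‖ ≤ L * ‖x - y‖)
    (hsc : ∀ x y : EuclideanSpace ℝ (Fin dim),
      μ * ‖x - y‖ ^ 2 ≤ ⟪x - y, (H.card : ℝ)⁻¹ • ∑ i ∈ H, (g i x - g i y)⟫)
    (xstar : EuclideanSpace ℝ (Fin dim))
    (hstar : ∀ i ∈ H, g i xstar = 0)
    (hratio : (f : ℝ) / ((N : ℝ) - f) ≤ μ / (3 * L))
    (α : ℝ) (hα0 : 0 < α) (hα : α ≤ μ / (4 * L ^ 2))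
    -- the execution: global estimates, submitted vectors, and CE-filtered index sets
    (xbar : ℕ → EuclideanSpace ℝ (Fin dim))
    (v : ℕ → Fin N → EuclideanSpace ℝ (Fin dim))
    (F : ℕ → Finset (Fin N))
    -- non-faulty agents submit one gradient-descent step from the current estimate;
    -- faulty agents `j ∉ H` submit arbitrary vectors `v k j`
    (hv : ∀ k, ∀ i ∈ H, v k i = xbar k - α • g i (xbar k))
    -- the CE filter keeps the `N - f` submissions closest to the current estimate
    (hFcard : ∀ k, (F k).card = N - f)
    (hsel : ∀ k, ∀ j ∈ F k, ∀ l ∉ F k, ‖xbar k - v k j‖ ≤ ‖xbar k - v k l‖)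
    -- the coordinator averages the retained submissions
    (hupd : ∀ k, xbar (k + 1) = ((N : ℝ) - f)⁻¹ • ∑ i ∈ F k, v k i) :
    ∀ k, ‖xbar k - xstar‖ ^ 2 ≤ (1 - μ * α / 6) ^ k * ‖xbar 0 - xstar‖ ^ 2 := by
  have hL : 0 < L := hμ.trans_le hμL
  have hαL : 0 ≤ α * L := by positivity
  rcases H.eq_empty_or_nonempty with rfl | hHne
  · have hzero : ∀ x : EuclideanSpace ℝ (Fin dim), ‖x - xstar‖ ^ 2 = 0 := by
      intro x
      have h := hsc x xstar
      simp only [Finset.sum_empty, smul_zero, inner_zero_right] at h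
      nlinarith [sq_nonneg ‖x - xstar‖]
    intro k
    simp [hzero]
  have hpos : 0 < N - f := hHcard ▸ hHne.card_pos
  have hcast : ((N - f : ℕ) : ℝ) = (N : ℝ) - f := Nat.cast_sub (by omega)
  have hn : (0 : ℝ) < (N : ℝ) - f := by
    rw [← hcast]
    exact_mod_cast hpos
  have hHcast : (H.card : ℝ) = (N : ℝ) - f := by rw [hHcard, hcast]
  have hgbound : ∀ i ∈ H, ∀ x, ‖g i x‖ ≤ L * ‖x - xstar‖ := by
    intro i hi x
    simpa [hstar i hi] using hlip i hi x xstar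
  have hcontract : ∀ k, ‖xbar (k + 1) - xstar‖ ^ 2 ≤
      (1 - μ * α / 6) * ‖xbar k - xstar‖ ^ 2 := by
    intro k
    set e := xbar k - xstar with he
    set d : Fin N → EuclideanSpace ℝ (Fin dim) := fun i => xbar k - v k i with hd
    set G := (H.card : ℝ)⁻¹ • ∑ i ∈ H, g i (xbar k) with hGdef
    set w := ((N : ℝ) - f)⁻¹ • (∑ i ∈ H, d i - ∑ i ∈ F k, d i) with hwdef
    have hcard : (F k).card = H.card := (hFcard k).trans hHcard.symm
    have hdg : ∀ i ∈ H, d i = α • g i (xbar k) := by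
      intro i hi
      simp [hd, hv k i hi]
    have hdH : ∀ i ∈ H, ‖d i‖ ≤ α * L * ‖e‖ := by
      intro i hi
      rw [hdg i hi, norm_smul, Real.norm_of_nonneg hα0.le, mul_assoc]
      gcongr
      exact hgbound i hi _
    have hdF : ∀ i ∈ F k, ‖d i‖ ≤ α * L * ‖e‖ := norm_le_on_selection hcard (hsel k) hdH
    have hFH : (F k \ H).card ≤ f := by
      have h₁ : (F k \ H).card ≤ Hᶜ.card := Finset.card_le_card fun i hi => by
        simpa using (Finset.mem_sdiff.1 hi).2
      rw [Finset.card_compl, Fintype.card_fin] at h₁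
      omega
    have hHF : (H \ F k).card ≤ f := by rwa [Finset.card_sdiff_comm hcard.symm]
    have hw : ‖w‖ ≤ 2 / 3 * (μ * α) * ‖e‖ := by
      have hsum := norm_sum_sub_sum_le_of_card_sdiff_le (by positivity) hHF hFH hdH hdF
      rw [hwdef, norm_smul, Real.norm_of_nonneg (inv_nonneg.2 hn.le)]
      calc ((N : ℝ) - f)⁻¹ * ‖∑ i ∈ H, d i - ∑ i ∈ F k, d i‖
          ≤ ((N : ℝ) - f)⁻¹ * (2 * f * (α * L * ‖e‖)) := by gcongr
        _ = f / ((N : ℝ) - f) * (2 * (α * L * ‖e‖)) := by ring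
        _ ≤ μ / (3 * L) * (2 * (α * L * ‖e‖)) := by gcongr
        _ = 2 / 3 * (μ * α) * ‖e‖ := by field_simp
    have hG : ‖G‖ ≤ L * ‖e‖ := by
      have h₁ := norm_sum_le_of_le H fun i hi => hgbound i hi (xbar k)
      rw [Finset.sum_const, nsmul_eq_mul, hHcast] at h₁
      rw [hGdef, norm_smul, hHcast, Real.norm_of_nonneg (inv_nonneg.2 hn.le),
        inv_mul_le_iff₀ hn]
      exact h₁
    have hin : μ * ‖e‖ ^ 2 ≤ ⟪e, G⟫ := by
      have h := hsc (xbar k) xstar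
      rwa [Finset.sum_congr rfl fun i hi => by rw [hstar i hi, sub_zero]] at h
    have hdecomp : xbar (k + 1) - xstar = e - α • G + w := by
      have hvd : ∑ i ∈ F k, v k i = ((N : ℝ) - f) • xbar k - ∑ i ∈ F k, d i := by
        simp only [hd, Finset.sum_sub_distrib, Finset.sum_const, hFcard k]
        rw [← Nat.cast_smul_eq_nsmul ℝ, hcast, sub_sub_cancel]
      have hGd : α • G = ((N : ℝ) - f)⁻¹ • ∑ i ∈ H, d i := by
        rw [hGdef, hHcast, smul_comm, Finset.smul_sum, Finset.sum_congr rfl hdg]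
      rw [hupd k, hvd, hGd, hwdef, smul_sub, smul_sub, inv_smul_smul₀ hn.ne', he]
      abel
    rw [hdecomp]
    exact norm_sq_sub_smul_add_le hμ hμL hα0 hα hG hin hw
  have hrate : 0 ≤ 1 - μ * α / 6 := by
    have h₁ : μ * α ≤ μ * (μ / (4 * L ^ 2)) := by gcongr
    have h₂ : μ * (μ / (4 * L ^ 2)) ≤ 1 := by
      rw [← mul_div_assoc, div_le_one (by positivity)]
      nlinarith
    linarith
  intro k
  induction k with
  | zero => simp
  | succ k ih =>
    calc ‖xbar (k + 1) - xstar‖ ^ 2 ≤ (1 - μ * α / 6) * ‖xbar k - xstar‖ ^ 2 := hcontract k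
      _ ≤ (1 - μ * α / 6) * ((1 - μ * α / 6) ^ k * ‖xbar 0 - xstar‖ ^ 2) := by gcongr
      _ = (1 - μ * α / 6) ^ (k + 1) * ‖xbar 0 - xstar‖ ^ 2 := by ring
end

section
/- (Theorem 2.) Assume the gradients of the non-faulty costs q^i (i ∈ H) are L-Lipschitz, the average non-faulty cost q^H is μ-strongly convex with 0 < μ ≤ L and unique minimizer x*_H, ∇q^i(x*_H) = 0 for every i ∈ H (which holds under 2f-redundancy), and f/(N−f) ≤ μ/(3L). Fix T ≥ 1 and a constant step size α with 0 < α ≤ μ/(16 T L²). Consider any deterministic execution of the local gradient-descent algorithm with CE filter: for each iteration k, every non-faulty agent i ∈ H computes x^i_{k,0} = x̄_k and x^i_{k,t+1} = x^i_{k,t} − α∇q^i(x^i_{k,t}) for t = 0,…,T−1 and submits v^k_i = x^i_{k,T}; every faulty agent j ∉ H submits an arbitrary vector v^k_j ∈ ℝ^d; F_k ⊆ {1,…,N} with |F_k| = N − f satisfies ‖x̄_k − v^k_j‖ ≤ ‖x̄_k − v^k_l‖ for all j ∈ F_k and l ∉ F_k; and x̄_{k+1} = (1/(N−f)) Σ_{i∈F_k}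 v^k_i. Then for every k ≥ 0, ‖x̄_k − x*_H‖² ≤ (1 − μTα/6)^k ‖x̄_0 − x*_H‖². -/
open scoped RealInnerProductSpace

/-- If `F` selects vectors of smallest norm, replacing `H` by `F` changes the sum by at most
`2 B` for every discarded element of `H`. -/
theorem norm_sum_sub_sum_le_of_comparative_elimination {E ι : Type*}
    [SeminormedAddCommGroup E] [DecidableEq ι] {F H : Finset ι} (hcard : F.card = H.card) {w : ι → E} {B : ℝ}
    (hB : ∀ i ∈ H, ‖w i‖ ≤ B) (hsel : ∀ j ∈ F, ∀ l ∉ F, ‖w j‖ ≤ ‖w l‖) :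
    ‖∑ i ∈ F, w i - ∑ i ∈ H, w i‖ ≤ 2 * (H \ F).card * B := by
  have hFH : (F \ H).card = (H \ F).card := Finset.card_sdiff_comm hcard
  have hout : ∀ i ∈ H \ F, ‖w i‖ ≤ B := fun i hi => hB i (Finset.mem_sdiff.1 hi).1
  have hin : ∀ j ∈ F \ H, ‖w j‖ ≤ B := by
    intro j hj
    obtain ⟨i, hi⟩ : (H \ F).Nonempty := by
      rw [← Finset.card_pos, ← hFH]
      exact Finset.card_pos.2 ⟨j, hj⟩
    exact (hsel j (Finset.mem_sdiff.1 hj).1 i (Finset.mem_sdiff.1 hi).2).trans (hout i hi)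
  rw [← Finset.sum_sdiff_sub_sum_sdiff]
  have h1 := norm_sum_le_of_le _ hin
  have h2 := norm_sum_le_of_le _ hout
  rw [Finset.sum_const, nsmul_eq_mul] at h1 h2
  rw [hFH] at h1
  linarith [norm_sub_le (∑ i ∈ F \ H, w i) (∑ i ∈ H \ F, w i)]

section LocalGradientDescent

variable {E : Type*} [NormedAddCommGroup E] [InnerProductSpace ℝ E]

/-- Drift of local gradient descent away from its starting point. -/
theorem norm_localGD_sub_start_le {h : E → E} {L α : ℝ} {p : E} {x : ℕ → E} {T : ℕ}
    (hL : 0 ≤ L) (hα : 0 ≤ α) (hlip : ∀ y z, ‖h y - h z‖ ≤ L * ‖y - z‖) (hp : h p = 0)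
    (hx : ∀ t < T, x (t + 1) = x t - α • h (x t)) (hs : α * L * T ≤ 1 / 16) :
    ∀ t ≤ T, ‖x t - x 0‖ ≤ 16 / 15 * (α * L) * t * ‖x 0 - p‖ := by
  intro t
  induction t with
  | zero => simp
  | succ t ih =>
    intro ht
    have hd := ih (by omega)
    have htT : (t : ℝ) ≤ T := by exact_mod_cast (by omega : t ≤ T)
    have hαL : 0 ≤ α * L := mul_nonneg hα hL
    have hst : α * L * t ≤ 1 / 16 := (mul_le_mul_of_nonneg_left htT hαL).trans hs
    have hr := norm_nonneg (x 0 - p)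
    have hd' : ‖x t - x 0‖ ≤ 1 / 15 * ‖x 0 - p‖ := by
      nlinarith [mul_le_mul_of_nonneg_right hst hr]
    have hg : ‖h (x t)‖ ≤ L * (16 / 15 * ‖x 0 - p‖) := by
      have h1 := hlip (x t) p
      rw [hp, sub_zero] at h1
      have h2 : ‖x t - p‖ ≤ ‖x t - x 0‖ + ‖x 0 - p‖ := norm_sub_le_norm_sub_add_norm_sub _ _ _
      exact h1.trans (mul_le_mul_of_nonneg_left (by linarith) hL)
    calc ‖x (t + 1) - x 0‖ = ‖(x t - x 0) - α • h (x t)‖ := by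
          rw [hx t (by omega)]; congr 1; abel
      _ ≤ ‖x t - x 0‖ + α * ‖h (x t)‖ := by
          refine (norm_sub_le _ _).trans_eq ?_
          rw [norm_smul, Real.norm_of_nonneg hα]
      _ ≤ 16 / 15 * (α * L) * t * ‖x 0 - p‖ + α * (L * (16 / 15 * ‖x 0 - p‖)) := by gcongr
      _ = _ := by push_cast; ring

/-- Local gradient descent is close to a single gradient step of combined length. -/
theorem norm_localGD_sub_single_step_le {h : E → E} {L α : ℝ} {p : E} {x : ℕ → E} {T : ℕ}
    (hL : 0 ≤ L) (hα : 0 ≤ α) (hlip : ∀ y z, ‖h y - h z‖ ≤ L * ‖y - z‖) (hp : h p = 0)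
    (hx : ∀ t < T, x (t + 1) = x t - α • h (x t)) (hs : α * L * T ≤ 1 / 16) :
    ∀ t ≤ T, ‖x t - x 0 + (α * t) • h (x 0)‖ ≤
      16 / 15 * (α * L) ^ 2 * T * t * ‖x 0 - p‖ := by
  intro t
  induction t with
  | zero => simp
  | succ t ih =>
    intro ht
    have hd := ih (by omega)
    have htT : (t : ℝ) ≤ T := by exact_mod_cast (by omega : t ≤ T)
    have hdrift := norm_localGD_sub_start_le hL hα hlip hp hx hs t (by omega)
    have hg : ‖h (x t) - h (x 0)‖ ≤ L * (16 / 15 * (α * L) * T * ‖x 0 - p‖) :=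
      (hlip _ _).trans (mul_le_mul_of_nonneg_left (hdrift.trans (by gcongr)) hL)
    calc ‖x (t + 1) - x 0 + (α * (t + 1 : ℕ)) • h (x 0)‖
        = ‖(x t - x 0 + (α * t) • h (x 0)) - α • (h (x t) - h (x 0))‖ := by
          rw [hx t (by omega)]; congr 1; push_cast; module
      _ ≤ ‖x t - x 0 + (α * t) • h (x 0)‖ + α * ‖h (x t) - h (x 0)‖ := by
          refine (norm_sub_le _ _).trans_eq ?_
          rw [norm_smul, Real.norm_of_nonneg hα]
      _ ≤ 16 / 15 * (α * L) ^ 2 * T * t * ‖x 0 - p‖ +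
            α * (L * (16 / 15 * (α * L) * T * ‖x 0 - p‖)) := by gcongr
      _ = _ := by push_cast; ring

/-- A gradient step contracts under strong monotonicity. -/
theorem norm_sub_smul_le_of_strong_monotone {e G : E} {L μ β : ℝ} (hβ : 0 ≤ β)
    (hβL : β * L ^ 2 ≤ μ / 16) (hβμ : β * μ ≤ 1 / 16) (hG : ‖G‖ ≤ L * ‖e‖)
    (hmono : μ * ‖e‖ ^ 2 ≤ ⟪e, G⟫) :
    ‖e - β • G‖ ≤ (1 - 31 / 32 * (β * μ)) * ‖e‖ := by
  refine le_of_sq_le_sq ?_ (mul_nonneg (by linarith) (norm_nonneg _))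
  rw [norm_sub_sq_real, inner_smul_right, norm_smul, Real.norm_of_nonneg hβ]
  have h1 : ‖G‖ ^ 2 ≤ (L * ‖e‖) ^ 2 := pow_le_pow_left₀ (norm_nonneg _) hG 2
  have h2 := mul_le_mul_of_nonneg_left h1 (sq_nonneg β)
  have h3 := mul_le_mul_of_nonneg_left hmono hβ
  have h4 := mul_le_mul_of_nonneg_left hβL (mul_nonneg hβ (sq_nonneg ‖e‖))
  nlinarith [sq_nonneg (β * μ * ‖e‖)]

/-- One communication round of local gradient descent with the comparative elimination filter. -/
theorem norm_ce_round_sub_le {ι : Type*} [DecidableEq ι] {F H : Finset ι}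
    (hcard : F.card = H.card) (hH : 0 < H.card) {g : ι → E → E} {L μ α : ℝ} {T : ℕ}
    (hμ : 0 < μ) (hμL : μ ≤ L)
    (hlip : ∀ i ∈ H, ∀ x y, ‖g i x - g i y‖ ≤ L * ‖x - y‖)
    (hsc : ∀ x y : E, μ * ‖x - y‖ ^ 2 ≤ ⟪x - y, (H.card : ℝ)⁻¹ • ∑ i ∈ H, (g i x - g i y)⟫)
    {p : E} (hp : ∀ i ∈ H, g i p = 0)
    (hdisc : ((H \ F).card : ℝ) / H.card ≤ μ / (3 * L))
    (hα : 0 ≤ α) (hstep : α * T * L ^ 2 ≤ μ / 16)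
    {z : E} {x : ι → ℕ → E} {v : ι → E}
    (hx0 : ∀ i ∈ H, x i 0 = z)
    (hxrec : ∀ i ∈ H, ∀ t < T, x i (t + 1) = x i t - α • g i (x i t))
    (hv : ∀ i ∈ H, v i = x i T)
    (hsel : ∀ j ∈ F, ∀ l ∉ F, ‖z - v j‖ ≤ ‖z - v l‖) :
    ‖(H.card : ℝ)⁻¹ • ∑ i ∈ F, v i - p‖ ≤ (1 - α * T * μ / 8) * ‖z - p‖ := by
  have hL : 0 < L := hμ.trans_le hμL
  have hm : (0 : ℝ) < H.card := by exact_mod_cast hH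
  set r := ‖z - p‖ with hr
  have hr0 : 0 ≤ r := norm_nonneg _
  have hβ : 0 ≤ α * T := by positivity
  have hs : α * L * T ≤ 1 / 16 := by
    have : (α * L * T) * L ≤ 1 / 16 * L := by nlinarith
    exact le_of_mul_le_mul_right this hL
  have hβμ : α * T * μ ≤ 1 / 16 := by nlinarith [mul_le_mul_of_nonneg_left hμL hβ]
  have hdrift : ∀ i ∈ H, ‖v i - z‖ ≤ 16 / 15 * (α * L) * T * r := by
    intro i hi
    have := norm_localGD_sub_start_le hL.le hα (hlip i hi) (hp i hi) (hxrec i hi) hs T le_rfl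
    rwa [hx0 i hi, ← hv i hi] at this
  have hdev : ∀ i ∈ H, ‖v i - z + (α * T) • g i z‖ ≤ 16 / 15 * (α * L) ^ 2 * T * T * r := by
    intro i hi
    have := norm_localGD_sub_single_step_le hL.le hα (hlip i hi) (hp i hi) (hxrec i hi) hs T le_rfl
    rwa [hx0 i hi, ← hv i hi] at this
  have hfilter := norm_sum_sub_sum_le_of_comparative_elimination hcard hdrift
    (fun j hj l hl => by simpa only [norm_sub_rev] using hsel j hj l hl)
  have hG : ∑ i ∈ H, (g i z - g i p) = ∑ i ∈ H, g i z :=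
    Finset.sum_congr rfl fun i hi => by rw [hp i hi, sub_zero]
  have hmono := hsc z p
  rw [hG] at hmono
  have hGnorm : ‖(H.card : ℝ)⁻¹ • ∑ i ∈ H, g i z‖ ≤ L * r := by
    have h1 : ‖∑ i ∈ H, (g i z - g i p)‖ ≤ ∑ _i ∈ H, L * r :=
      norm_sum_le_of_le _ fun i hi => hlip i hi z p
    rw [hG, Finset.sum_const, nsmul_eq_mul] at h1
    rw [norm_smul, norm_inv, Real.norm_of_nonneg hm.le]
    exact (inv_mul_le_iff₀ hm).2 h1
  have hdescent := norm_sub_smul_le_of_strong_monotone hβ hstep hβμ hGnorm hmono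
  have hδ : ‖(H.card : ℝ)⁻¹ • ∑ i ∈ H, (v i - z + (α * T) • g i z)‖ ≤ α * T * μ / 15 * r := by
    have h1 := norm_sum_le_of_le _ hdev
    rw [Finset.sum_const, nsmul_eq_mul] at h1
    rw [norm_smul, norm_inv, Real.norm_of_nonneg hm.le]
    refine ((inv_mul_le_iff₀ hm).2 h1).trans (mul_le_mul_of_nonneg_right ?_ hr0)
    nlinarith [mul_le_mul_of_nonneg_left hstep hβ]
  have hE : ‖(H.card : ℝ)⁻¹ • (∑ i ∈ F, (v i - z) - ∑ i ∈ H, (v i - z))‖ ≤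
      32 / 45 * (α * T * μ) * r := by
    rw [norm_smul, norm_inv, Real.norm_of_nonneg hm.le]
    calc (H.card : ℝ)⁻¹ * ‖∑ i ∈ F, (v i - z) - ∑ i ∈ H, (v i - z)‖
        ≤ (H.card : ℝ)⁻¹ * (2 * (H \ F).card * (16 / 15 * (α * L) * T * r)) := by gcongr
      _ = ((H \ F).card : ℝ) / H.card * (32 / 15 * (α * L) * T * r) := by ring
      _ ≤ μ / (3 * L) * (32 / 15 * (α * L) * T * r) := by gcongr
      _ = _ := by field_simp; ring
  have hsplit : (H.card : ℝ)⁻¹ • ∑ i ∈ F, v i - p =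
      ((z - p) - (α * T) • ((H.card : ℝ)⁻¹ • ∑ i ∈ H, g i z)) +
      (H.card : ℝ)⁻¹ • ∑ i ∈ H, (v i - z + (α * T) • g i z) +
      (H.card : ℝ)⁻¹ • (∑ i ∈ F, (v i - z) - ∑ i ∈ H, (v i - z)) := by
    simp only [Finset.sum_add_distrib, Finset.sum_sub_distrib, Finset.sum_const,
      ← Finset.smul_sum, hcard, ← Nat.cast_smul_eq_nsmul ℝ]
    have hz : (H.card : ℝ)⁻¹ • (H.card : ℝ) • z = z := inv_smul_smul₀ hm.ne' z
    simp only [smul_add, smul_sub, hz]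
    module
  rw [hsplit]
  refine norm_add₃_le.trans ?_
  nlinarith [mul_nonneg (mul_nonneg hβ hμ.le) hr0]

end LocalGradientDescent

/-- **Theorem 2: exact fault-tolerance of local GD with the CE filter (`T ≥ 1`, deterministic).**
Under `2f`-redundancy (used via `∇q^i(x*_H) = 0` for all `i ∈ H`), `f/(N-f) ≤ μ/(3L)`, and
step size `0 < α ≤ μ/(16TL²)`, the iterates of local gradient descent (with `T` local steps
per iteration) with the comparative elimination filter satisfy
`‖x̄_k - x*_H‖² ≤ (1 - μTα/6)^k ‖x̄_0 - x*_H‖²`, for every possible behaviour of the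
Byzantine agents. -/
theorem local_gd_ce_exact_fault_tolerance_T
    (dim N f : ℕ)
    (H : Finset (Fin N)) (hHcard : H.card = N - f)
    (q : Fin N → EuclideanSpace ℝ (Fin dim) → ℝ)
    (g : Fin N → EuclideanSpace ℝ (Fin dim) → EuclideanSpace ℝ (Fin dim))
    (L μ : ℝ) (hμ : 0 < μ) (hμL : μ ≤ L)
    (hgrad : ∀ i ∈ H, ∀ x, HasGradientAt (q i) (g i x) x)
    (hlip : ∀ i ∈ H, ∀ x y, ‖g i x - g i y‖ ≤ L * ‖x - y‖)
    (hsc : ∀ x y : EuclideanSpace ℝ (Fin dim),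
      μ * ‖x - y‖ ^ 2 ≤ ⟪x - y, (H.card : ℝ)⁻¹ • ∑ i ∈ H, (g i x - g i y)⟫)
    (xstar : EuclideanSpace ℝ (Fin dim))
    (hstar : ∀ i ∈ H, g i xstar = 0)
    (hratio : (f : ℝ) / ((N : ℝ) - f) ≤ μ / (3 * L))
    (T : ℕ) (hT : 1 ≤ T)
    (α : ℝ) (hα0 : 0 < α) (hα : α ≤ μ / (16 * T * L ^ 2))
    -- the execution: global estimates, local iterates, submitted vectors, CE-filtered sets
    (xbar : ℕ → EuclideanSpace ℝ (Fin dim))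
    (xloc : ℕ → Fin N → ℕ → EuclideanSpace ℝ (Fin dim))
    (v : ℕ → Fin N → EuclideanSpace ℝ (Fin dim))
    (F : ℕ → Finset (Fin N))
    -- local iterates: `x^i_{k,0} = x̄_k`, `x^i_{k,t+1} = x^i_{k,t} - α ∇q^i(x^i_{k,t})`
    (hx0 : ∀ k, ∀ i ∈ H, xloc k i 0 = xbar k)
    (hxrec : ∀ k, ∀ i ∈ H, ∀ t < T, xloc k i (t + 1) = xloc k i t - α • g i (xloc k i t))
    -- non-faulty agents submit `x^i_{k,T}`; faulty agents submit arbitrary vectors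
    (hv : ∀ k, ∀ i ∈ H, v k i = xloc k i T)
    -- the CE filter keeps the `N - f` submissions closest to the current estimate
    (hFcard : ∀ k, (F k).card = N - f)
    (hsel : ∀ k, ∀ j ∈ F k, ∀ l ∉ F k, ‖xbar k - v k j‖ ≤ ‖xbar k - v k l‖)
    -- the coordinator averages the retained submissions
    (hupd : ∀ k, xbar (k + 1) = ((N : ℝ) - f)⁻¹ • ∑ i ∈ F k, v k i) :
    ∀ k, ‖xbar k - xstar‖ ^ 2 ≤ (1 - μ * T * α / 6) ^ k * ‖xbar 0 - xstar‖ ^ 2 := by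
  have hdeg : H.card = 0 → ∀ x y : EuclideanSpace ℝ (Fin dim), x = y := by
    intro h0 x y
    have h := hsc x y
    rw [h0, Nat.cast_zero, inv_zero, zero_smul, inner_zero_right] at h
    have : ‖x - y‖ ^ 2 = 0 := le_antisymm (by nlinarith [sq_nonneg ‖x - y‖]) (sq_nonneg _)
    exact sub_eq_zero.1 (norm_eq_zero.1 (pow_eq_zero_iff two_ne_zero |>.1 this))
  have hL : 0 < L := hμ.trans_le hμL
  have hT0 : (0 : ℝ) < T := by exact_mod_cast hT
  have hstep : α * T * L ^ 2 ≤ μ / 16 := by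
    rw [le_div_iff₀ (by positivity)] at hα
    linarith
  have hβ : 0 ≤ α * T := by positivity
  have hβμ : α * T * μ ≤ 1 / 16 := by
    have h1 : (α * T * μ) * μ ≤ 1 / 16 * μ := by
      have : μ ^ 2 ≤ L ^ 2 := pow_le_pow_left₀ hμ.le hμL 2
      nlinarith [mul_le_mul_of_nonneg_left this hβ]
    exact le_of_mul_le_mul_right h1 hμ
  have hround : ∀ k, ‖xbar (k + 1) - xstar‖ ≤ (1 - α * T * μ / 8) * ‖xbar k - xstar‖ := by
    intro k
    rcases Nat.eq_zero_or_pos H.card with h0 | hpos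
    · rw [hdeg h0 (xbar (k + 1)) xstar, hdeg h0 (xbar k) xstar]
      simp
    · have hfN : f ≤ N := by omega
      have hcast : (N : ℝ) - f = H.card := by rw [hHcard, Nat.cast_sub hfN]
      have hdisc : (H \ F k).card ≤ f := by
        calc (H \ F k).card ≤ (F k)ᶜ.card :=
              Finset.card_le_card fun i hi => Finset.mem_compl.2 (Finset.mem_sdiff.1 hi).2
          _ = f := by rw [Finset.card_compl, hFcard, Fintype.card_fin]; omega
      rw [hcast] at hratio
      rw [hupd, hcast]
      refine norm_ce_round_sub_le ((hFcard k).trans hHcard.symm) hpos hμ hμL hlip hsc hstar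
        (le_trans ?_ hratio) hα0.le hstep (hx0 k) (hxrec k) (hv k) (hsel k)
      gcongr
  intro k
  induction k with
  | zero => simp
  | succ k ih =>
    have hq : 0 ≤ 1 - μ * T * α / 6 := by nlinarith
    have hsq : (1 - α * T * μ / 8) ^ 2 ≤ 1 - μ * T * α / 6 := by
      nlinarith [mul_nonneg hβ hμ.le]
    calc ‖xbar (k + 1) - xstar‖ ^ 2
        ≤ ((1 - α * T * μ / 8) * ‖xbar k - xstar‖) ^ 2 :=
          pow_le_pow_left₀ (norm_nonneg _) (hround k) 2
      _ = (1 - α * T * μ / 8) ^ 2 * ‖xbar k - xstar‖ ^ 2 := by ring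
      _ ≤ (1 - μ * T * α / 6) * ((1 - μ * T * α / 6) ^ k * ‖xbar 0 - xstar‖ ^ 2) := by gcongr
      _ = _ := by ring
end
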